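/- Kazdan–Kramer logarithmic transformation identity (key computation of Theorem 1.8): Let E = EuclideanSpace ℝ (Fin n), let p ≥ 2 be real, and let x ∈ E. Let φ : E → ℝ be differentiable on a neighborhood of x with φ > 0 on that neighborhood, and suppose the field Y := fun y => ‖∇φ y‖^(p−2) • ∇φ y is differentiable at x. Define v := fun y => −Real.log (φ y). Then the field fun y => ‖∇v y‖^(p−2) • ∇v y is differentiable at x, and Δ_p v x − (p − 1) · ‖∇v x‖^p = − (Δ_p φ x) / (φ x)^(p−1). -/

import Mathlib

open RealInnerProductSpace MeasureTheory

/-- The divergence of a vector field: the trace of its Fréchet derivative. -/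
noncomputable def vdiv {n : ℕ} (X : EuclideanSpace ℝ (Fin n) → EuclideanSpace ℝ (Fin n))
    (x : EuclideanSpace ℝ (Fin n)) : ℝ :=
  LinearMap.trace ℝ (EuclideanSpace ℝ (Fin n)) (fderiv ℝ X x).toLinearMap

/-- The divergence product rule `div (u • X) = u • div X + du(X)`. -/
theorem vdiv_smul {n : ℕ} {u : EuclideanSpace ℝ (Fin n) → ℝ}
    {X : EuclideanSpace ℝ (Fin n) → EuclideanSpace ℝ (Fin n)} {x : EuclideanSpace ℝ (Fin n)}
    (hu : DifferentiableAt ℝ u x) (hX : DifferentiableAt ℝ X x) :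
    vdiv (fun y => u y • X y) x = u x * vdiv X x + fderiv ℝ u x (X x) := by
  have h : (fderiv ℝ (fun y => u y • X y) x).toLinearMap =
      u x • (fderiv ℝ X x).toLinearMap + (fderiv ℝ u x).toLinearMap.smulRight (X x) := by
    rw [fderiv_fun_smul hu hX]
    rfl
  rw [vdiv, h, map_add, map_smul, LinearMap.trace_smulRight, vdiv]
  rfl

/-- The gradient of `-log φ` is `-φ⁻¹ ∇φ`. -/
theorem gradient_neg_log {n : ℕ} {φ : EuclideanSpace ℝ (Fin n) → ℝ}
    {y : EuclideanSpace ℝ (Fin n)} (hd : DifferentiableAt ℝ φ y) (h0 : φ y ≠ 0) :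
    gradient (fun z => -Real.log (φ z)) y = -((φ y)⁻¹ • gradient φ y) := by
  have h := (hd.hasFDerivAt.log h0).fun_neg.fderiv
  rw [gradient, h, gradient, map_neg, map_smul]

/-- The `p`-Laplacian flux of `-log φ` is `-φ^(1-p)` times that of `φ`. -/
theorem norm_rpow_smul_gradient_neg_log {n : ℕ} (p : ℝ) {φ : EuclideanSpace ℝ (Fin n) → ℝ}
    {y : EuclideanSpace ℝ (Fin n)} (hd : DifferentiableAt ℝ φ y) (h0 : 0 < φ y) :
    ‖gradient (fun z => -Real.log (φ z)) y‖ ^ (p - 2) • gradient (fun z => -Real.log (φ z)) y =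
      (-(φ y) ^ (1 - p)) • (‖gradient φ y‖ ^ (p - 2) • gradient φ y) := by
  rw [gradient_neg_log hd h0.ne', norm_neg, norm_smul, Real.norm_of_nonneg (inv_nonneg.2 h0.le),
    Real.mul_rpow (inv_nonneg.2 h0.le) (norm_nonneg _), smul_neg, neg_smul, smul_smul, smul_smul,
    Real.inv_rpow h0.le, ← Real.rpow_neg h0.le, ← Real.rpow_neg_one (φ y)]
  congr 2
  rw [mul_right_comm, ← Real.rpow_add h0]
  ring_nf

/-- Kazdan–Kramer logarithmic transformation identity
(key computation of Theorem 1.8). -/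
theorem kazdan_kramer_log_transform (n : ℕ) (p : ℝ) (hp : 2 ≤ p)
    (x : EuclideanSpace ℝ (Fin n))
    (φ : EuclideanSpace ℝ (Fin n) → ℝ)
    (hφ : ∃ s ∈ nhds x, (∀ y ∈ s, 0 < φ y) ∧ DifferentiableOn ℝ φ s)
    (hY : DifferentiableAt ℝ (fun y => ‖gradient φ y‖ ^ (p - 2) • gradient φ y) x) :
    DifferentiableAt ℝ
        (fun y => ‖gradient (fun z => -Real.log (φ z)) y‖ ^ (p - 2) •
          gradient (fun z => -Real.log (φ z)) y) x ∧
      vdiv (fun y => ‖gradient (fun z => -Real.log (φ z)) y‖ ^ (p - 2) •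
            gradient (fun z => -Real.log (φ z)) y) x -
          (p - 1) * ‖gradient (fun z => -Real.log (φ z)) x‖ ^ p =
        -(vdiv (fun y => ‖gradient φ y‖ ^ (p - 2) • gradient φ y) x) / (φ x) ^ (p - 1) := by
  obtain ⟨s, hs, hpos, hdiff⟩ := hφ
  have hx : 0 < φ x := hpos x (mem_of_mem_nhds hs)
  have hdx : DifferentiableAt ℝ φ x := hdiff.differentiableAt hs
  have heq : (fun y => ‖gradient (fun z => -Real.log (φ z)) y‖ ^ (p - 2) •
      gradient (fun z => -Real.log (φ z)) y) =ᶠ[nhds x]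
      fun y => (-(φ y) ^ (1 - p)) • (‖gradient φ y‖ ^ (p - 2) • gradient φ y) := by
    filter_upwards [eventually_mem_nhds_iff.2 hs] with y hy
    exact norm_rpow_smul_gradient_neg_log p (hdiff.differentiableAt hy)
      (hpos y (mem_of_mem_nhds hy))
  have hu : HasFDerivAt (fun y => -(φ y) ^ (1 - p))
      (-(((1 - p) * φ x ^ (1 - p - 1)) • fderiv ℝ φ x)) x :=
    (hdx.hasFDerivAt.rpow_const (Or.inl hx.ne')).fun_neg
  refine ⟨(hu.differentiableAt.fun_smul hY).congr_of_eventuallyEq heq, ?_⟩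
  have hpair : fderiv ℝ φ x (‖gradient φ x‖ ^ (p - 2) • gradient φ x) = ‖gradient φ x‖ ^ p := by
    have hself : fderiv ℝ φ x (gradient φ x) = ‖gradient φ x‖ ^ (2 : ℝ) := by
      rw [Real.rpow_two, ← real_inner_self_eq_norm_sq]
      exact inner_gradient_left.symm
    rw [map_smul, hself, smul_eq_mul,
      ← Real.rpow_add_of_nonneg (norm_nonneg _) (by linarith) (by norm_num), sub_add_cancel]
  have hnorm : ‖gradient (fun z => -Real.log (φ z)) x‖ ^ p = φ x ^ (-p) * ‖gradient φ x‖ ^ p := by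
    rw [gradient_neg_log hdx hx.ne', norm_neg, norm_smul,
      Real.norm_of_nonneg (inv_nonneg.2 hx.le), Real.mul_rpow (inv_nonneg.2 hx.le) (norm_nonneg _),
      Real.inv_rpow hx.le, Real.rpow_neg hx.le]
  have hdiv := vdiv_smul hu.differentiableAt hY
  rw [hu.fderiv, neg_apply, smul_apply, hpair,
    smul_eq_mul, show 1 - p - 1 = -p by ring] at hdiv
  rw [vdiv, ← heq.fderiv_eq, ← vdiv] at hdiv
  rw [hdiv, hnorm, div_eq_mul_inv, ← Real.rpow_neg hx.le, neg_sub]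
  ring
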